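/- Let λ ∈ X⁺ be a dominant weight, α ∈ R a root, ν ∈ E, and let x, y ∈ W and m, m' ∈ ℤ satisfy x·λ = ν − mα and y·λ = ν − m'α. Then x = y or x = s_α∘y. -/

import Mathlib

open scoped InnerProductSpace Classical

noncomputable section

variable {E : Type*} [NormedAddCommGroup E] [InnerProductSpace ℝ E]

/-- `⟨x, α∨⟩ = 2⟪x,α⟫/⟪α,α⟫`. -/
def coPair (x α : E) : ℝ := 2 * ⟪x, α⟫_ℝ / ⟪α, α⟫_ℝ

/-- The orthogonal reflection `s_α(x) = x − ⟨x,α∨⟩α`, as a plain function. -/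
def sRefl (α x : E) : E := x - coPair x α • α

/-- `R` is a finite crystallographic root system in `E`. -/
structure IsRootSystem (R : Finset E) : Prop where
  span_eq_top : Submodule.span ℝ (R : Set E) = ⊤
  zero_not_mem : (0 : E) ∉ R
  refl_stable : ∀ α ∈ R, ∀ β ∈ R, sRefl α β ∈ R
  crystallographic : ∀ α ∈ R, ∀ β ∈ R, ∃ n : ℤ, coPair β α = (n : ℝ)

/-- The positive roots with respect to a regular vector `v`. -/
def posR (R : Finset E) (v : E) : Finset E := R.filter fun α => 0 < ⟪v, α⟫_ℝ

/-- `ρ`, the half sum of the positive roots. -/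
def rhoR (R : Finset E) (v : E) : E := (2 : ℝ)⁻¹ • ∑ α ∈ posR R v, α

/-- The Weyl group: the group of linear isometries of `E` generated by the
reflections `s_α`, `α ∈ R`. -/
def Weyl (R : Finset E) : Subgroup (E ≃ₗᵢ[ℝ] E) :=
  Subgroup.closure {g | ∃ α ∈ R, ∀ x, g x = sRefl α x}

/-- The dot action `w·λ = w(λ+ρ) − ρ`. -/
def dotAct (R : Finset E) (v : E) (w : E ≃ₗᵢ[ℝ] E) (lam : E) : E :=
  w (lam + rhoR R v) - rhoR R v

/-- membership in the weight lattice `X`. -/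
def IsWeight (R : Finset E) (lam : E) : Prop := ∀ α ∈ R, ∃ n : ℤ, coPair lam α = (n : ℝ)

/-- membership in `X⁺`, the set of dominant weights. -/
def IsDominant (R : Finset E) (v : E) (lam : E) : Prop :=
  IsWeight R lam ∧ ∀ α ∈ posR R v, 0 ≤ coPair lam α

/-- the strict dominance order `λ < μ`:  `μ − λ` is a nonzero `ℕ`-linear
combination of positive roots. -/
def domLt (R : Finset E) (v : E) (lam mu : E) : Prop :=
  lam ≠ mu ∧ ∃ c : E → ℕ, mu - lam = ∑ α ∈ posR R v, (c α : ℝ) • α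

/-- `V_β(λ,μ)`. -/
def VsetB (R : Finset E) (v lam mu β : E) : Set ((E ≃ₗᵢ[ℝ] E) × ℤ) :=
  {p | p.1 ∈ Weyl R ∧ 0 < p.2 ∧ (p.2 : ℝ) < coPair (mu + rhoR R v) β ∧
    dotAct R v p.1 lam = mu - (p.2 : ℝ) • β}

/-- `U_γ(λ,μ)`. -/
def UsetG (R : Finset E) (v lam mu γ : E) : Set ((E ≃ₗᵢ[ℝ] E) × ℤ) :=
  {p | p.1 ∈ Weyl R ∧ (p.2 < 0 ∨ coPair (lam + rhoR R v) γ < (p.2 : ℝ)) ∧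
    dotAct R v p.1 mu = lam - (p.2 : ℝ) • γ}

/-- `V(λ,μ)`. -/
def Vset (R : Finset E) (v lam mu : E) : Set (E × (E ≃ₗᵢ[ℝ] E) × ℤ) :=
  {t | t.1 ∈ posR R v ∧ (t.2.1, t.2.2) ∈ VsetB R v lam mu t.1}

/-- `U(λ,μ)`. -/
def Uset (R : Finset E) (v lam mu : E) : Set (E × (E ≃ₗᵢ[ℝ] E) × ℤ) :=
  {t | t.1 ∈ posR R v ∧ (t.2.1, t.2.2) ∈ UsetG R v lam mu t.1}

/-! ### Reflections -/

/-- The reflection `s_α` as a linear isometry. -/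
def reflIso (α : E) : E ≃ₗᵢ[ℝ] E := (ℝ ∙ α)ᗮ.reflection

lemma reflIso_apply (α x : E) : reflIso α x = sRefl α x := by
  rw [reflIso, Submodule.reflection_orthogonal_apply, Submodule.reflection_singleton_apply,
    sRefl, coPair, real_inner_comm x α, real_inner_self_eq_norm_sq, neg_sub,
    ← Nat.cast_smul_eq_nsmul ℝ, smul_smul]
  congr 2
  push_cast
  simp only [RCLike.ofReal_real_eq_id, id_eq]
  ring

lemma reflIso_mul_self (α : E) : reflIso α * reflIso α = 1 := by
  exact Submodule.reflection_mul_reflection _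

lemma sRefl_sRefl (α x : E) : sRefl α (sRefl α x) = x := by
  rw [← reflIso_apply α x, ← reflIso_apply]
  exact DFunLike.congr_fun (reflIso_mul_self α) x

lemma coPair_self {α : E} (h : α ≠ 0) : coPair α α = 2 := by
  have : ⟪α, α⟫_ℝ ≠ 0 := inner_self_ne_zero.2 h
  rw [coPair, mul_div_assoc, div_self this, mul_one]

lemma sRefl_self {α : E} (h : α ≠ 0) : sRefl α α = -α := by
  rw [sRefl, coPair_self h]
  module

lemma coPair_pos {α x : E} (h : α ≠ 0) (hx : 0 < ⟪x, α⟫_ℝ) : 0 < coPair x α := by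
  have : 0 < ⟪α, α⟫_ℝ := real_inner_self_pos.2 h
  rw [coPair]
  positivity

lemma reflIso_map (w : E ≃ₗᵢ[ℝ] E) (α : E) : reflIso (w α) * w = w * reflIso α := by
  ext x
  simp [reflIso_apply, sRefl, coPair]

lemma reflIso_smul {c : ℝ} (hc : c ≠ 0) (α : E) : reflIso (c • α) = reflIso α := by
  have h : (ℝ ∙ (c • α)) = ℝ ∙ α := Submodule.span_singleton_smul_eq (IsUnit.mk0 c hc) α
  simp only [reflIso, h]

lemma eq_or_eq_sRefl_of_eq_sub_smul {u u' α : E} (hα : α ≠ 0) (hn : ‖u‖ = ‖u'‖) {k : ℝ}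
    (h : u = u' - k • α) : u = u' ∨ u = sRefl α u' := by
  have hpos : ⟪α, α⟫_ℝ ≠ 0 := inner_self_ne_zero.2 hα
  have e : ⟪u, u⟫_ℝ = ⟪u', u'⟫_ℝ := by
    rw [real_inner_self_eq_norm_sq, real_inner_self_eq_norm_sq, hn]
  rw [h] at e
  simp only [inner_sub_left, inner_sub_right, inner_smul_left, inner_smul_right,
    RCLike.conj_to_real, real_inner_comm u' α] at e
  have e' : k * (k * ⟪α, α⟫_ℝ - 2 * ⟪u', α⟫_ℝ) = 0 := by linarith [real_inner_comm u' α]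
  rcases mul_eq_zero.1 e' with hk | hk
  · left
    rw [h, hk]
    simp
  · right
    rw [h, sRefl, coPair]
    congr 2
    field_simp
    linarith

/-! ### Positive systems and their simple roots -/

section PositiveSystem

variable {R : Finset E} {v : E}

lemma mem_posR {β : E} : β ∈ posR R v ↔ β ∈ R ∧ 0 < ⟪v, β⟫_ℝ := by
  simp [posR]

lemma IsRootSystem.ne_zero (hR : IsRootSystem R) {β : E} (h : β ∈ R) : β ≠ 0 :=
  fun h0 => hR.zero_not_mem (h0 ▸ h)

lemma IsRootSystem.neg_mem (hR : IsRootSystem R) {β : E} (h : β ∈ R) : -β ∈ R := by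
  rw [← sRefl_self (hR.ne_zero h)]
  exact hR.refl_stable β h β h

lemma mem_posR_or_neg_mem_posR (hR : IsRootSystem R) (hv : ∀ α ∈ R, ⟪v, α⟫_ℝ ≠ 0)
    {β : E} (h : β ∈ R) : β ∈ posR R v ∨ -β ∈ posR R v := by
  rcases lt_or_gt_of_ne (hv β h) with h' | h'
  · right
    exact mem_posR.2 ⟨hR.neg_mem h, by rw [inner_neg_right]; linarith⟩
  · left
    exact mem_posR.2 ⟨h, h'⟩

/-- `G` consists of positive roots spanning the extreme rays of the cone generated by the
positive roots, one for each ray. -/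
structure IsSimpleSystem (R : Finset E) (v : E) (G : Finset E) : Prop where
  subset : G ⊆ posR R v
  mem_span : ∀ β ∈ posR R v, β ∈ Submodule.span NNReal (G : Set E)
  sRefl_mem : ∀ α ∈ G, ∀ β ∈ posR R v, (∀ c : ℝ, β ≠ c • α) → sRefl α β ∈ posR R v

lemma eq_zero_or_inner_pos_of_mem_span {S : Set E} (hS : ∀ s ∈ S, 0 < ⟪v, s⟫_ℝ) {z : E}
    (hz : z ∈ Submodule.span NNReal S) : z = 0 ∨ 0 < ⟪v, z⟫_ℝ := by
  induction hz using Submodule.span_induction with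
  | mem x hx => exact Or.inr (hS x hx)
  | zero => exact Or.inl rfl
  | add x y _ _ hx hy =>
    rcases hx with rfl | hx
    · simpa using hy
    · rcases hy with rfl | hy
      · simpa using Or.inr hx
      · right
        rw [inner_add_right]
        linarith
  | smul a x _ hx =>
    rcases hx with rfl | hx
    · simp
    · rcases eq_or_ne a 0 with rfl | ha
      · simp
      · right
        rw [NNReal.smul_def, inner_smul_right]
        have : (0 : ℝ) < a := by exact_mod_cast pos_iff_ne_zero.2 ha
        positivity

lemma exists_inner_pos_of_mem_span {S : Set E} {x z : E} (hz : z ∈ Submodule.span NNReal S)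
    (h : 0 < ⟪x, z⟫_ℝ) : ∃ s ∈ S, 0 < ⟪x, s⟫_ℝ := by
  by_contra! hS
  have : ⟪x, z⟫_ℝ ≤ 0 := by
    clear h
    induction hz using Submodule.span_induction with
    | mem s hs => exact hS s hs
    | zero => simp
    | add a b _ _ ha hb =>
      rw [inner_add_right]
      linarith
    | smul a b _ hb =>
      rw [NNReal.smul_def, inner_smul_right]
      exact mul_nonpos_of_nonneg_of_nonpos a.2 hb
  linarith

lemma exists_isSimpleSystem (hR : IsRootSystem R) (hv : ∀ α ∈ R, ⟪v, α⟫_ℝ ≠ 0) :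
    ∃ G, IsSimpleSystem R v G := by
  let F : Finset (Finset E) := (posR R v).powerset.filter
    fun G => ∀ β ∈ posR R v, β ∈ Submodule.span NNReal (G : Set E)
  have hF : F.Nonempty := ⟨posR R v, by
    simp only [F, Finset.mem_filter, Finset.mem_powerset, subset_refl, true_and]
    exact fun β hβ => Submodule.subset_span hβ⟩
  obtain ⟨G, hGF, hmin⟩ := Finset.exists_min_image F Finset.card hF
  simp only [F, Finset.mem_filter, Finset.mem_powerset] at hGF hmin
  obtain ⟨hsub, hspan⟩ := hGF
  refine ⟨G, hsub, hspan, fun α hα β hβ hne => ?_⟩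
  have hαP := mem_posR.1 (hsub hα)
  have hβP := mem_posR.1 hβ
  rcases mem_posR_or_neg_mem_posR hR hv (hR.refl_stable α hαP.1 β hβP.1) with h | hδ
  · exact h
  exfalso
  have hins : (G : Set E) = insert α ((G.erase α : Finset E) : Set E) := by
    rw [← Finset.coe_insert, Finset.insert_erase hα]
  have hβs := hspan β hβ
  have hδs := hspan _ hδ
  rw [hins, Submodule.mem_span_insert] at hβs hδs
  obtain ⟨a, z, hz, hza⟩ := hβs
  obtain ⟨b, z', hz', hzb⟩ := hδs
  have hpos : ∀ s ∈ ((G.erase α : Finset E) : Set E), 0 < ⟪v, s⟫_ℝ := fun s hs =>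
    (mem_posR.1 (hsub (Finset.mem_of_mem_erase hs))).2
  have hsum : (coPair β α - a - b) • α = z + z' := by
    have h1 : z = β - (a : ℝ) • α := by rw [hza, NNReal.smul_def]; abel
    have h2 : z' = -(β - coPair β α • α) - (b : ℝ) • α := by
      rw [← sRefl, hzb, NNReal.smul_def]; abel
    rw [h1, h2]
    module
  rcases lt_or_ge 0 (coPair β α - a - b) with hc | hc
  · have hαmem : α ∈ Submodule.span NNReal ((G.erase α : Finset E) : Set E) := by
      have h := Submodule.smul_mem _ (Real.toNNReal (coPair β α - a - b)⁻¹)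
        (Submodule.add_mem _ hz hz')
      rwa [← hsum, NNReal.smul_def, Real.coe_toNNReal _ (inv_pos.2 hc).le, smul_smul,
        inv_mul_cancel₀ hc.ne', one_smul] at h
    have hle := hmin (G.erase α) ⟨(Finset.erase_subset _ _).trans hsub, fun γ hγ => by
      refine (Submodule.span_le.2 ?_ : Submodule.span NNReal (G : Set E) ≤ _) (hspan γ hγ)
      rw [hins]
      exact Set.insert_subset hαmem Submodule.subset_span⟩
    exact absurd (Finset.card_erase_lt_of_mem hα) (not_lt.2 hle)
  · have hv' : ⟪v, z⟫_ℝ + ⟪v, z'⟫_ℝ ≤ 0 := by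
      rw [← inner_add_right, ← hsum, inner_smul_right]
      exact mul_nonpos_of_nonpos_of_nonneg hc hαP.2.le
    have hz0 : z = 0 := by
      rcases eq_zero_or_inner_pos_of_mem_span hpos hz with h | h
      · exact h
      · rcases eq_zero_or_inner_pos_of_mem_span hpos hz' with h' | h'
        · rw [h', inner_zero_right] at hv'
          linarith
        · linarith
    exact hne a (by rw [hza, hz0, add_zero, NNReal.smul_def])

variable {G : Finset E}

/-! ### Words in simple reflections -/

/-- `w` is a product of `n` reflections in elements of `G`. -/
def IsWord (G : Finset E) (n : ℕ) (w : E ≃ₗᵢ[ℝ] E) : Prop :=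
  ∃ L : List E, (∀ a ∈ L, a ∈ G) ∧ L.length = n ∧ (L.map reflIso).prod = w

lemma IsSimpleSystem.reflIso_mem_closure (hG : IsSimpleSystem R v G) (hR : IsRootSystem R)
    {β : E} (hβ : β ∈ posR R v) :
    reflIso β ∈ Subgroup.closure (reflIso '' (G : Set E)) := by
  by_contra hcon
  let B := (posR R v).filter fun β => reflIso β ∉ Subgroup.closure (reflIso '' (G : Set E))
  have hB : B.Nonempty := ⟨β, Finset.mem_filter.2 ⟨hβ, hcon⟩⟩
  obtain ⟨γ, hγB, hmin⟩ := Finset.exists_min_image B (fun β => ⟪v, β⟫_ℝ) hB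
  obtain ⟨hγ, hγn⟩ := Finset.mem_filter.1 hγB
  have hγ0 := hR.ne_zero (mem_posR.1 hγ).1
  obtain ⟨α, hα, hpos⟩ := exists_inner_pos_of_mem_span (hG.mem_span γ hγ)
    (real_inner_self_pos.2 hγ0)
  have hαP := mem_posR.1 (hG.subset hα)
  have hαW : reflIso α ∈ Subgroup.closure (reflIso '' (G : Set E)) :=
    Subgroup.subset_closure ⟨α, hα, rfl⟩
  by_cases hpar : ∃ c : ℝ, γ = c • α
  · obtain ⟨c, rfl⟩ := hpar
    have hc : c ≠ 0 := by
      rintro rfl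
      simp at hγ0
    rw [reflIso_smul hc] at hγn
    exact hγn hαW
  · push Not at hpar
    have hmem := hG.sRefl_mem α hα γ hγ hpar
    have hlt : ⟪v, sRefl α γ⟫_ℝ < ⟪v, γ⟫_ℝ := by
      rw [sRefl, inner_sub_right, inner_smul_right]
      have := mul_pos (coPair_pos (hR.ne_zero hαP.1) hpos) hαP.2
      linarith
    have hW : reflIso (sRefl α γ) ∈ Subgroup.closure (reflIso '' (G : Set E)) := by
      by_contra h
      exact absurd (hmin _ (Finset.mem_filter.2 ⟨hmem, h⟩)) (not_le.2 hlt)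
    apply hγn
    have h := reflIso_map (reflIso α) γ
    rw [reflIso_apply] at h
    have h' : reflIso γ = reflIso α * (reflIso (sRefl α γ) * reflIso α) := by
      rw [h, ← mul_assoc, reflIso_mul_self, one_mul]
    rw [h']
    exact mul_mem hαW (mul_mem hW hαW)

lemma IsSimpleSystem.weyl_le_closure (hG : IsSimpleSystem R v G) (hR : IsRootSystem R)
    (hv : ∀ α ∈ R, ⟪v, α⟫_ℝ ≠ 0) :
    Weyl R ≤ Subgroup.closure (reflIso '' (G : Set E)) := by
  refine (Subgroup.closure_le _).2 ?_
  rintro g ⟨β, hβ, hg⟩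
  have hgβ : g = reflIso β := by
    ext x
    rw [hg, reflIso_apply]
  rw [hgβ]
  rcases mem_posR_or_neg_mem_posR hR hv hβ with h | h
  · exact hG.reflIso_mem_closure hR h
  · have h' := hG.reflIso_mem_closure hR h
    rwa [← neg_one_smul ℝ β, reflIso_smul (by norm_num)] at h'

lemma exists_isWord_of_mem_closure {w : E ≃ₗᵢ[ℝ] E}
    (hw : w ∈ Subgroup.closure (reflIso '' (G : Set E))) : ∃ n, IsWord G n w := by
  rw [← Subgroup.mem_toSubmonoid, Subgroup.closure_toSubmonoid] at hw
  obtain ⟨l, hl, rfl⟩ := Submonoid.exists_list_of_mem_closure hw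
  clear hw
  induction l with
  | nil => exact ⟨0, [], by simp⟩
  | cons g l ih =>
    obtain ⟨n, L, hL, hn, hprod⟩ := ih fun x hx => hl x (List.mem_cons_of_mem _ hx)
    obtain ⟨a, ha, hga⟩ : ∃ a ∈ G, reflIso a = g := by
      rcases hl g List.mem_cons_self with ⟨a, ha, h⟩ | ⟨a, ha, h⟩
      · exact ⟨a, ha, h⟩
      · refine ⟨a, ha, ?_⟩
        rw [← inv_inv g, ← h]
        exact eq_inv_of_mul_eq_one_left (reflIso_mul_self a)
    refine ⟨n + 1, a :: L, ?_, by simp [hn], by simp [hprod, hga]⟩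
    simpa [ha] using hL

lemma IsSimpleSystem.exists_isWord_mul (hG : IsSimpleSystem R v G) (hR : IsRootSystem R)
    {α : E} (hα : α ∈ G) (L : List E) (hL : ∀ a ∈ L, a ∈ G)
    (hneg : (L.map reflIso).prod α ∉ posR R v) :
    ∃ n, n + 1 = L.length ∧ IsWord G n ((L.map reflIso).prod * reflIso α) := by
  induction L with
  | nil => exact absurd (hG.subset hα) (by simpa using hneg)
  | cons a L ih =>
    have hL' : ∀ x ∈ L, x ∈ G := fun x hx => hL x (List.mem_cons_of_mem _ hx)
    have ha : a ∈ G := hL a List.mem_cons_self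
    set u := (L.map reflIso).prod with hu
    by_cases hpos : u α ∈ posR R v
    · have hpar : ∃ c : ℝ, u α = c • a := by
        by_contra! hne
        apply hneg
        have h := hG.sRefl_mem a ha _ hpos hne
        rw [← reflIso_apply] at h
        simpa [← hu] using h
      obtain ⟨c, hc⟩ := hpar
      have hc0 : c ≠ 0 := by
        rintro rfl
        rw [zero_smul] at hc
        exact hR.ne_zero (mem_posR.1 hpos).1 hc
      have h := reflIso_map u α
      rw [hc, reflIso_smul hc0] at h
      refine ⟨L.length, by simp, L, hL', rfl, ?_⟩
      rw [List.map_cons, List.prod_cons, ← hu, mul_assoc, ← h, ← mul_assoc, reflIso_mul_self,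
        one_mul]
    · obtain ⟨n, hn, L₁, hL₁, hlen, hprod⟩ := ih hL' hpos
      refine ⟨n + 1, by simp [hn], a :: L₁, ?_, by simp [hlen], ?_⟩
      · simpa [ha] using hL₁
      · rw [List.map_cons, List.prod_cons, hprod, List.map_cons, List.prod_cons, mul_assoc]

lemma IsSimpleSystem.eq_one_of_isWord (hG : IsSimpleSystem R v G) (hR : IsRootSystem R)
    {w : E ≃ₗᵢ[ℝ] E} (hwv : w v = v) {n : ℕ} (hw : IsWord G n w) : w = 1 := by
  induction n using Nat.strong_induction_on with
  | _ n ih =>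
    obtain ⟨L, hL, hn, hprod⟩ := hw
    rcases List.eq_nil_or_concat L with rfl | ⟨L', α, hLα⟩
    · simpa using hprod.symm
    · rw [List.concat_eq_append] at hLα
      subst hLα
      have hα : α ∈ G := hL α (by simp)
      have hαP := mem_posR.1 (hG.subset hα)
      have hL' : ∀ a ∈ L', a ∈ G := fun a ha => hL a (by simp [ha])
      have hprod' : (L'.map reflIso).prod * reflIso α = w := by simpa using hprod
      have hneg : (L'.map reflIso).prod α ∉ posR R v := by
        intro h
        have h1 : w α = -((L'.map reflIso).prod α) := by
          rw [← hprod', LinearIsometryEquiv.coe_mul, Function.comp_apply, reflIso_apply,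
            sRefl_self (hR.ne_zero hαP.1), map_neg]
        have h2 : ⟪v, w α⟫_ℝ = ⟪v, α⟫_ℝ := by
          conv_lhs => rw [← hwv]
          exact w.inner_map_map v α
        rw [h1, inner_neg_right] at h2
        linarith [(mem_posR.1 h).2, hαP.2]
      obtain ⟨k, hk, hword⟩ := hG.exists_isWord_mul hR hα L' hL' hneg
      rw [hprod'] at hword
      have hlt : k < n := by
        rw [List.length_append, List.length_singleton] at hn
        omega
      exact ih k hlt hword

/-- The Weyl group acts freely on regular vectors. -/
theorem eq_one_of_mem_weyl_of_apply_eq (hR : IsRootSystem R) (hv : ∀ α ∈ R, ⟪v, α⟫_ℝ ≠ 0)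
    {w : E ≃ₗᵢ[ℝ] E} (hw : w ∈ Weyl R) (hwv : w v = v) : w = 1 := by
  obtain ⟨G, hG⟩ := exists_isSimpleSystem hR hv
  obtain ⟨n, hn⟩ := exists_isWord_of_mem_closure (hG.weyl_le_closure hR hv hw)
  exact hG.eq_one_of_isWord hR hwv hn

/-! ### Regularity of `ρ` -/

lemma IsSimpleSystem.inner_rhoR_pos (hG : IsSimpleSystem R v G) (hR : IsRootSystem R) {α : E}
    (hα : α ∈ G) : 0 < ⟪rhoR R v, α⟫_ℝ := by
  have hαP := mem_posR.1 (hG.subset hα)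
  have hα0 := hR.ne_zero hαP.1
  let A := (posR R v).filter fun β => ∃ c : ℝ, β = c • α
  let B := (posR R v).filter fun β => ¬ ∃ c : ℝ, β = c • α
  have hB : ∑ β ∈ B, sRefl α β = ∑ β ∈ B, β := by
    have hmap : ∀ β ∈ B, sRefl α β ∈ B := by
      intro β hβ
      obtain ⟨h1, h2⟩ := Finset.mem_filter.1 hβ
      refine Finset.mem_filter.2 ⟨hG.sRefl_mem α hα β h1 (not_exists.1 h2), ?_⟩
      rintro ⟨c, hc⟩
      refine h2 ⟨c + coPair β α, ?_⟩
      rw [add_smul, ← hc, sRefl]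
      abel
    exact Finset.sum_nbij' (sRefl α) (sRefl α) hmap hmap (fun β _ => sRefl_sRefl α β)
      (fun β _ => sRefl_sRefl α β) (fun _ _ => rfl)
  have hB0 : ⟪∑ β ∈ B, β, α⟫_ℝ = 0 := by
    have h : reflIso α (∑ β ∈ B, β) = ∑ β ∈ B, β := by
      rw [map_sum]
      simpa only [reflIso_apply] using hB
    have h1 := (reflIso α).inner_map_map (∑ β ∈ B, β) α
    rw [h, reflIso_apply, sRefl_self hα0, inner_neg_right] at h1
    linarith
  have hA : 0 < ⟪∑ β ∈ A, β, α⟫_ℝ := by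
    rw [sum_inner]
    refine Finset.sum_pos ?_ ⟨α, Finset.mem_filter.2 ⟨hG.subset hα, 1, (one_smul ℝ α).symm⟩⟩
    intro β hβ
    obtain ⟨h1, c, rfl⟩ := Finset.mem_filter.1 hβ
    have h2 := (mem_posR.1 h1).2
    rw [inner_smul_right] at h2
    have hc : 0 < c := (pos_iff_pos_of_mul_pos h2).2 hαP.2
    rw [real_inner_smul_left]
    exact mul_pos hc (real_inner_self_pos.2 hα0)
  have hsplit : ∑ β ∈ A, β + ∑ β ∈ B, β = ∑ β ∈ posR R v, β :=
    Finset.sum_filter_add_sum_filter_not _ _ _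
  rw [rhoR, real_inner_smul_left, ← hsplit, inner_add_left, hB0]
  linarith

lemma inner_rhoR_pos (hR : IsRootSystem R) (hv : ∀ α ∈ R, ⟪v, α⟫_ℝ ≠ 0) {β : E}
    (hβ : β ∈ posR R v) : 0 < ⟪rhoR R v, β⟫_ℝ := by
  obtain ⟨G, hG⟩ := exists_isSimpleSystem hR hv
  exact (eq_zero_or_inner_pos_of_mem_span (fun s hs => hG.inner_rhoR_pos hR hs)
    (hG.mem_span β hβ)).resolve_left (hR.ne_zero (mem_posR.1 hβ).1)

lemma IsDominant.inner_add_rhoR_ne_zero {lam : E} (hlam : IsDominant R v lam)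
    (hR : IsRootSystem R) (hv : ∀ α ∈ R, ⟪v, α⟫_ℝ ≠ 0) :
    ∀ β ∈ R, ⟪lam + rhoR R v, β⟫_ℝ ≠ 0 := by
  have key : ∀ β ∈ posR R v, 0 < ⟪lam + rhoR R v, β⟫_ℝ := by
    intro β hβ
    have h1 := inner_rhoR_pos hR hv hβ
    have h2 : 0 ≤ ⟪lam, β⟫_ℝ := by
      by_contra! h
      have h3 := coPair_pos (x := -lam) (hR.ne_zero (mem_posR.1 hβ).1)
        (by rw [inner_neg_left]; linarith)
      have h4 : coPair (-lam) β = -coPair lam β := by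
        simp only [coPair, inner_neg_left]
        ring
      linarith [hlam.2 β hβ]
    rw [inner_add_left]
    linarith
  intro β hβ
  rcases mem_posR_or_neg_mem_posR hR hv hβ with h | h
  · exact (key β h).ne'
  · have h' := key _ h
    rw [inner_neg_right] at h'
    linarith

end PositiveSystem


theorem statement3 [FiniteDimensional ℝ E] (R : Finset E) (hR : IsRootSystem R)
    (v : E) (hv : ∀ α ∈ R, ⟪v, α⟫_ℝ ≠ 0)
    (lam : E) (hlam : IsDominant R v lam)
    (α : E) (hα : α ∈ R) (ν : E)
    (x y : E ≃ₗᵢ[ℝ] E) (hx : x ∈ Weyl R) (hy : y ∈ Weyl R)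
    (m m' : ℤ)
    (h1 : dotAct R v x lam = ν - (m : ℝ) • α)
    (h2 : dotAct R v y lam = ν - (m' : ℝ) • α) :
    x = y ∨ ∀ z, x z = sRefl α (y z) := by
  have hreg := hlam.inner_add_rhoR_ne_zero hR hv
  set μ := lam + rhoR R v with hμ
  have free : ∀ {g h : E ≃ₗᵢ[ℝ] E}, g ∈ Weyl R → h ∈ Weyl R → g μ = h μ → g = h := by
    intro g h hg hh e
    have hfix : (h⁻¹ * g) μ = μ := by
      rw [LinearIsometryEquiv.coe_mul, Function.comp_apply, e]
      exact h.symm_apply_apply μ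
    exact (inv_mul_eq_one.1 (eq_one_of_mem_weyl_of_apply_eq hR hreg
      (mul_mem (inv_mem hh) hg) hfix)).symm
  have hline : x μ = y μ - ((m : ℝ) - m') • α := by
    rw [dotAct, ← hμ, sub_eq_iff_eq_add] at h1 h2
    rw [h1, h2]
    module
  rcases eq_or_eq_sRefl_of_eq_sub_smul (hR.ne_zero hα) (by simp) hline with h | h
  · exact Or.inl (free hx hy h)
  · right
    have hs : reflIso α ∈ Weyl R := Subgroup.subset_closure ⟨α, hα, reflIso_apply α⟩
    have hxy : x = reflIso α * y := free hx (mul_mem hs hy) (by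
      rw [h, LinearIsometryEquiv.coe_mul, Function.comp_apply, reflIso_apply])
    intro z
    rw [hxy, LinearIsometryEquiv.coe_mul, Function.comp_apply, reflIso_apply]

end
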